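/- Let G, c > 0 and r₀ > 0 be constants. There exist no twice differentiable functions u, v : (r₀, ∞) → ℝ and function ρ : (r₀, ∞) → ℝ with ρ(r) > 0 for all r, satisfying simultaneously, for all r > r₀: (i) −e^{u−v}·[u''/2 + u'/r + (u'/4)(u'−v')] = −(4πG/c⁴)·e^{u}·ρ(r); (ii) u''/2 − v'/r + (u'/4)(u'−v') = 0; (iii) e^{−v}·[1 − e^{v} + (r/2)(u'−v')] = 0; and (iv) u'(r)·ρ(r) = 0. -/

import Mathlib

open Real

/-- The Einstein field equations with cosmic microwave background still have no static
spherically symmetric solution when the energy density `ρ` is regarded as an unknown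
positive function: no twice differentiable `u, v` and positive `ρ` on `(r₀,∞)` satisfy
`R₀₀ = (4πG/c⁴)g₀₀ρ`, `R₁₁ = 0`, `R₂₂ = 0` and the conservation condition `u'·ρ = 0`. -/
theorem no_solution_with_CMB_unknown_density
    (G c r₀ : ℝ) (hG : 0 < G) (hc : 0 < c) (hr₀ : 0 < r₀) :
    ¬ ∃ (u u' u'' v v' v'' ρ : ℝ → ℝ),
      (∀ r ∈ Set.Ioi r₀, 0 < ρ r) ∧
      (∀ r ∈ Set.Ioi r₀, HasDerivAt u (u' r) r) ∧
      (∀ r ∈ Set.Ioi r₀, HasDerivAt u' (u'' r) r) ∧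
      (∀ r ∈ Set.Ioi r₀, HasDerivAt v (v' r) r) ∧
      (∀ r ∈ Set.Ioi r₀, HasDerivAt v' (v'' r) r) ∧
      (∀ r ∈ Set.Ioi r₀,
        -Real.exp (u r - v r) * (u'' r / 2 + u' r / r + (u' r / 4) * (u' r - v' r))
          = -(4 * π * G / c ^ 4) * Real.exp (u r) * ρ r) ∧
      (∀ r ∈ Set.Ioi r₀, u'' r / 2 - v' r / r + (u' r / 4) * (u' r - v' r) = 0) ∧
      (∀ r ∈ Set.Ioi r₀,
        Real.exp (-v r) * (1 - Real.exp (v r) + (r / 2) * (u' r - v' r)) = 0) ∧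
      (∀ r ∈ Set.Ioi r₀, u' r * ρ r = 0) := by
  rintro ⟨u, u', u'', v, v', v'', ρ, hρ, -, hu', -, -, h1, -, -, h4⟩
  have hz : ∀ r ∈ Set.Ioi r₀, u' r = 0 := fun r hr =>
    (mul_eq_zero.mp (h4 r hr)).resolve_right (hρ r hr).ne'
  have hm : r₀ + 1 ∈ Set.Ioi r₀ := by simp
  have hd : HasDerivAt u' 0 (r₀ + 1) :=
    (hasDerivAt_const (r₀ + 1) (0 : ℝ)).congr_of_eventuallyEq
      (Filter.eventuallyEq_of_mem (Ioi_mem_nhds hm) hz)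
  have hz2 : u'' (r₀ + 1) = 0 := (hu' _ hm).unique hd
  have h := h1 _ hm
  rw [hz _ hm, hz2] at h
  have hp : 0 < (4 * π * G / c ^ 4) * Real.exp (u (r₀ + 1)) * ρ (r₀ + 1) := by
    have := hρ _ hm
    positivity
  simp only [zero_div, zero_mul, add_zero, mul_zero] at h
  linarith
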